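/- arXiv:2010.06774 — 3 statements merged into one kernel-verified Lean document; each statement's English description precedes it below -/
import Mathlib

section
/- (Fictitious Space Lemma.) Let V̄ and V be real Hilbert spaces, let B̄ : V̄' → V̄ and B : V' → V be bounded linear isomorphisms that are symmetric and positive definite (SPD), and let Π : V̄ → V be a bounded linear operator with dual map Π* : V' → V̄'. Assume: (i) there is a constant c₀ > 0 with ‖Π v̄‖_{B⁻¹} ≤ c₀ ‖v̄‖_{B̄⁻¹} for all v̄ ∈ V̄; and (ii) there is a constant c₁ > 0 such that for every v ∈ V there exists v̄ ∈ V̄ with Π v̄ = v and ‖v̄‖_{B̄⁻¹} ≤ c₁ ‖v‖_{B⁻¹}. Then, setting B̃ := Π ∘ B̄ ∘ Π* : V' → V, one has c₀⁻² ⟨r, B̃ r⟩ ≤ ⟨r, B r⟩ ≤ c₁² ⟨r, B̃ r⟩ for all r ∈ V'. -/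
/-- A positive definite operator from the dual is positive semidefinite. -/
lemma apply_apply_nonneg_of_pos {V : Type*} [NormedAddCommGroup V] [InnerProductSpace ℝ V]
    (B : (V →L[ℝ] ℝ) ≃L[ℝ] V) (hpos : ∀ r : V →L[ℝ] ℝ, r ≠ 0 → 0 < r (B r))
    (r : V →L[ℝ] ℝ) : 0 ≤ r (B r) := by
  by_cases hr : r = 0
  · simp [hr]
  · exact (hpos r hr).le

/-- The quadratic form of the inverse of a positive definite operator is nonnegative. -/
lemma symm_apply_apply_nonneg_of_pos {V : Type*} [NormedAddCommGroup V] [InnerProductSpace ℝ V]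
    (B : (V →L[ℝ] ℝ) ≃L[ℝ] V) (hpos : ∀ r : V →L[ℝ] ℝ, r ≠ 0 → 0 < r (B r))
    (v : V) : 0 ≤ B.symm v v := by
  simpa using apply_apply_nonneg_of_pos B hpos (B.symm v)

/-- Cauchy–Schwarz inequality between a functional and a vector, in the norms induced by a
symmetric positive definite operator and its inverse. -/
lemma sq_apply_le_mul_symm_apply {V : Type*} [NormedAddCommGroup V] [InnerProductSpace ℝ V]
    (B : (V →L[ℝ] ℝ) ≃L[ℝ] V) (hsym : ∀ r s : V →L[ℝ] ℝ, r (B s) = s (B r))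
    (hpos : ∀ r : V →L[ℝ] ℝ, r ≠ 0 → 0 < r (B r)) (r : V →L[ℝ] ℝ) (v : V) :
    r v ^ 2 ≤ r (B r) * B.symm v v := by
  obtain ⟨s, rfl⟩ := B.surjective v
  rw [B.symm_apply_apply]
  have h : ∀ t : ℝ, 0 ≤ s (B s) * (t * t) + 2 * r (B s) * t + r (B r) := fun t => by
    have ht := apply_apply_nonneg_of_pos B hpos (r + t • s)
    simp only [map_add, map_smul, add_apply, smul_apply,
      smul_eq_mul, hsym s r] at ht
    linarith
  have hd := discrim_le_zero h
  rw [discrim] at hd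
  linarith

lemma le_sq_mul_of_sqrt_le_mul_sqrt {a b c : ℝ} (ha : 0 ≤ a) (hb : 0 ≤ b)
    (h : Real.sqrt a ≤ c * Real.sqrt b) : a ≤ c ^ 2 * b := by
  have h2 := pow_le_pow_left₀ (Real.sqrt_nonneg a) h 2
  rwa [mul_pow, Real.sq_sqrt ha, Real.sq_sqrt hb] at h2

lemma le_of_sq_le_mul {x y : ℝ} (hy : 0 ≤ y) (h : x ^ 2 ≤ y * x) : x ≤ y := by
  by_contra! hlt
  nlinarith

/-- Fictitious Space Lemma. -/
theorem stmt1
    {Vb V : Type*} [NormedAddCommGroup Vb] [InnerProductSpace ℝ Vb] [CompleteSpace Vb]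
    [NormedAddCommGroup V] [InnerProductSpace ℝ V] [CompleteSpace V]
    (Bb : (Vb →L[ℝ] ℝ) ≃L[ℝ] Vb) (B : (V →L[ℝ] ℝ) ≃L[ℝ] V)
    (hBbsym : ∀ r s : Vb →L[ℝ] ℝ, r (Bb s) = s (Bb r))
    (hBbpos : ∀ r : Vb →L[ℝ] ℝ, r ≠ 0 → 0 < r (Bb r))
    (hBsym : ∀ r s : V →L[ℝ] ℝ, r (B s) = s (B r))
    (hBpos : ∀ r : V →L[ℝ] ℝ, r ≠ 0 → 0 < r (B r))
    (P : Vb →L[ℝ] V)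
    (c₀ c₁ : ℝ) (hc₀ : 0 < c₀) (hc₁ : 0 < c₁)
    (hbound : ∀ vb : Vb,
      Real.sqrt (B.symm (P vb) (P vb)) ≤ c₀ * Real.sqrt (Bb.symm vb vb))
    (hsurj : ∀ v : V, ∃ vb : Vb, P vb = v ∧
      Real.sqrt (Bb.symm vb vb) ≤ c₁ * Real.sqrt (B.symm v v)) :
    ∀ r : V →L[ℝ] ℝ,
      (c₀ ^ 2)⁻¹ * r (P (Bb (r.comp P))) ≤ r (B r) ∧
      r (B r) ≤ c₁ ^ 2 * r (P (Bb (r.comp P))) := by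
  intro r
  have hX := apply_apply_nonneg_of_pos Bb hBbpos (r.comp P)
  have hA := apply_apply_nonneg_of_pos B hBpos r
  simp only [ContinuousLinearMap.comp_apply] at hX
  constructor
  · rw [inv_mul_le_iff₀ (by positivity)]
    have hle := le_sq_mul_of_sqrt_le_mul_sqrt (symm_apply_apply_nonneg_of_pos B hBpos _)
      (symm_apply_apply_nonneg_of_pos Bb hBbpos _) (hbound (Bb (r.comp P)))
    rw [Bb.symm_apply_apply, ContinuousLinearMap.comp_apply] at hle
    refine le_of_sq_le_mul (by positivity) ?_
    calc r (P (Bb (r.comp P))) ^ 2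
        ≤ r (B r) * B.symm (P (Bb (r.comp P))) (P (Bb (r.comp P))) :=
          sq_apply_le_mul_symm_apply B hBsym hBpos r _
      _ ≤ r (B r) * (c₀ ^ 2 * r (P (Bb (r.comp P)))) := by gcongr
      _ = c₀ ^ 2 * r (B r) * r (P (Bb (r.comp P))) := by ring
  · obtain ⟨vb, hvb, hle⟩ := hsurj (B r)
    replace hle := le_sq_mul_of_sqrt_le_mul_sqrt (symm_apply_apply_nonneg_of_pos Bb hBbpos _)
      (symm_apply_apply_nonneg_of_pos B hBpos _) hle
    rw [B.symm_apply_apply] at hle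
    have hcs := sq_apply_le_mul_symm_apply Bb hBbsym hBbpos (r.comp P) vb
    simp only [ContinuousLinearMap.comp_apply, hvb] at hcs
    refine le_of_sq_le_mul (by positivity) ?_
    calc r (B r) ^ 2
        ≤ r (P (Bb (r.comp P))) * Bb.symm vb vb := hcs
      _ ≤ r (P (Bb (r.comp P))) * (c₁ ^ 2 * r (B r)) := by gcongr
      _ = c₁ ^ 2 * r (P (Bb (r.comp P))) * r (B r) := by ring
end

section
/- Let V, W⁻, and W be real Hilbert spaces and let D : W⁻ → V and I : W → V be bounded linear operators with dual maps D* : V' → (W⁻)' and I* : V' → W'. Assume there is a constant C_stab > 0 such that for every v ∈ V there exist w⁻ ∈ W⁻ and w ∈ W with v = D w⁻ + I w and ‖w⁻‖²_{W⁻} + ‖w‖²_W ≤ C_stab ‖v‖²_V. Then for every r ∈ V', (‖D‖² + ‖I‖²)⁻¹ ( ‖D* r‖²_{(W⁻)'} + ‖I* r‖²_{W'} ) ≤ ‖r‖²_{V'} ≤ C_stab ( ‖D* r‖²_{(W⁻)'} + ‖I* r‖²_{W'} ), where ‖D‖ and ‖I‖ denote the operator norms of D and I. -/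
/-- Two-sided bound on the dual norm via a stable two-term splitting
`v = D w⁻ + I w`. -/
theorem stmt2
    {V Wm W : Type*} [NormedAddCommGroup V] [InnerProductSpace ℝ V] [CompleteSpace V]
    [NormedAddCommGroup Wm] [InnerProductSpace ℝ Wm] [CompleteSpace Wm]
    [NormedAddCommGroup W] [InnerProductSpace ℝ W] [CompleteSpace W]
    (D : Wm →L[ℝ] V) (I : W →L[ℝ] V)
    (Cstab : ℝ) (hC : 0 < Cstab)
    (hdecomp : ∀ v : V, ∃ (wm : Wm) (w : W),
      v = D wm + I w ∧ ‖wm‖ ^ 2 + ‖w‖ ^ 2 ≤ Cstab * ‖v‖ ^ 2) :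
    ∀ r : V →L[ℝ] ℝ,
      (‖D‖ ^ 2 + ‖I‖ ^ 2)⁻¹ * (‖r.comp D‖ ^ 2 + ‖r.comp I‖ ^ 2) ≤ ‖r‖ ^ 2 ∧
      ‖r‖ ^ 2 ≤ Cstab * (‖r.comp D‖ ^ 2 + ‖r.comp I‖ ^ 2) := by
  intro r
  constructor
  · refine inv_mul_le_of_le_mul₀ (by positivity) (by positivity) ?_
    have hD : ‖r.comp D‖ ^ 2 ≤ (‖r‖ * ‖D‖) ^ 2 := by
      gcongr
      exact r.opNorm_comp_le D
    have hI : ‖r.comp I‖ ^ 2 ≤ (‖r‖ * ‖I‖) ^ 2 := by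
      gcongr
      exact r.opNorm_comp_le I
    linarith [mul_pow ‖r‖ ‖D‖ 2, mul_pow ‖r‖ ‖I‖ 2]
  · set a := ‖r.comp D‖
    set b := ‖r.comp I‖
    have hS : 0 ≤ Cstab * (a ^ 2 + b ^ 2) := by positivity
    refine (Real.le_sqrt (norm_nonneg r) hS).1 (r.opNorm_le_bound (Real.sqrt_nonneg _) fun v ↦ ?_)
    obtain ⟨wm, w, hv, hw⟩ := hdecomp v
    have hr : ‖r v‖ ≤ a * ‖wm‖ + b * ‖w‖ := by
      calc ‖r v‖ = ‖r.comp D wm + r.comp I w‖ := by simp [hv]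
        _ ≤ ‖r.comp D wm‖ + ‖r.comp I w‖ := norm_add_le _ _
        _ ≤ a * ‖wm‖ + b * ‖w‖ :=
          add_le_add ((r.comp D).le_opNorm wm) ((r.comp I).le_opNorm w)
    refine (sq_le_sq₀ (norm_nonneg _) (by positivity)).1 ?_
    calc ‖r v‖ ^ 2 ≤ (a * ‖wm‖ + b * ‖w‖) ^ 2 := by gcongr
      _ ≤ (a ^ 2 + b ^ 2) * (‖wm‖ ^ 2 + ‖w‖ ^ 2) := by
        linarith [sq_nonneg (a * ‖w‖ - b * ‖wm‖)]
      _ ≤ (a ^ 2 + b ^ 2) * (Cstab * ‖v‖ ^ 2) := by gcongr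
      _ = (√(Cstab * (a ^ 2 + b ^ 2)) * ‖v‖) ^ 2 := by
        rw [mul_pow, Real.sq_sqrt hS]
        ring
end

section
/- (Additive-Schwarz spectral equivalence via stable subspace decomposition.) Let H be a real Hilbert space and V₀, V₁, …, V_N closed subspaces of H, each equipped with the inherited inner product. Assume there is a constant C_stab > 0 such that every v ∈ H can be written as v = Σ_{i=0}^{N} v_i with v_i ∈ V_i and Σ_{i=0}^{N} ‖v_i‖²_H ≤ C_stab ‖v‖²_H. For r ∈ H' and 0 ≤ i ≤ N write ‖r‖_{V_i'} := sup_{0 ≠ v ∈ V_i} ⟨r, v⟩ / ‖v‖_H. Then for every r ∈ H', (N+1)⁻¹ Σ_{i=0}^{N} ‖r‖²_{V_i'} ≤ ‖r‖²_{H'} ≤ C_stab Σ_{i=0}^{N} ‖r‖²_{V_i'}. -/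
theorem norm_comp_subtypeL_le {H : Type*} [NormedAddCommGroup H] [InnerProductSpace ℝ H]
    (W : Submodule ℝ H) (r : H →L[ℝ] ℝ) : ‖r.comp W.subtypeL‖ ≤ ‖r‖ :=
  ContinuousLinearMap.opNorm_le_bound _ (norm_nonneg r) fun w => r.le_opNorm (w : H)

theorem norm_apply_le_of_mem {H : Type*} [NormedAddCommGroup H] [InnerProductSpace ℝ H]
    (W : Submodule ℝ H) (r : H →L[ℝ] ℝ) {w : H} (hw : w ∈ W) :
    ‖r w‖ ≤ ‖r.comp W.subtypeL‖ * ‖w‖ :=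
  (r.comp W.subtypeL).le_opNorm ⟨w, hw⟩


/-- additive-Schwarz spectral equivalence via a stable subspace
decomposition. -/
theorem stmt6
    {H : Type*} [NormedAddCommGroup H] [InnerProductSpace ℝ H] [CompleteSpace H]
    (N : ℕ) (V : Fin (N + 1) → Submodule ℝ H)
    (hclosed : ∀ i, IsClosed (V i : Set H))
    (Cstab : ℝ) (hC : 0 < Cstab)
    (hdecomp : ∀ v : H, ∃ vs : Fin (N + 1) → H,
      (∀ i, vs i ∈ V i) ∧ v = ∑ i, vs i ∧ ∑ i, ‖vs i‖ ^ 2 ≤ Cstab * ‖v‖ ^ 2) :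
    ∀ r : H →L[ℝ] ℝ,
      ((N : ℝ) + 1)⁻¹ * ∑ i, ‖r.comp (V i).subtypeL‖ ^ 2 ≤ ‖r‖ ^ 2 ∧
      ‖r‖ ^ 2 ≤ Cstab * ∑ i, ‖r.comp (V i).subtypeL‖ ^ 2 := by
  intro r
  constructor
  · rw [inv_mul_le_iff₀ (by positivity)]
    calc ∑ i, ‖r.comp (V i).subtypeL‖ ^ 2 ≤ ∑ _i : Fin (N + 1), ‖r‖ ^ 2 :=
          Finset.sum_le_sum fun i _ => by
            gcongr
            exact norm_comp_subtypeL_le (V i) r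
      _ = ((N : ℝ) + 1) * ‖r‖ ^ 2 := by simp
  · set S := ∑ i, ‖r.comp (V i).subtypeL‖ ^ 2
    have hS0 : 0 ≤ S := Finset.sum_nonneg fun i _ => sq_nonneg _
    rw [← Real.le_sqrt (norm_nonneg r) (mul_nonneg hC.le hS0)]
    refine r.opNorm_le_bound (Real.sqrt_nonneg _) fun v => ?_
    obtain ⟨vs, hmem, hsum, hle⟩ := hdecomp v
    have hrv : ‖r v‖ ≤ ∑ i, ‖r.comp (V i).subtypeL‖ * ‖vs i‖ := by
      rw [hsum, map_sum]
      exact norm_sum_le_of_le _ fun i _ => norm_apply_le_of_mem (V i) r (hmem i)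
    refine abs_le_of_sq_le_sq' ?_ (by positivity) |>.2
    calc ‖r v‖ ^ 2 ≤ (∑ i, ‖r.comp (V i).subtypeL‖ * ‖vs i‖) ^ 2 :=
          pow_le_pow_left₀ (norm_nonneg _) hrv 2
      _ ≤ S * ∑ i, ‖vs i‖ ^ 2 := Finset.sum_mul_sq_le_sq_mul_sq _ _ _
      _ ≤ S * (Cstab * ‖v‖ ^ 2) := mul_le_mul_of_nonneg_left hle hS0
      _ = (√(Cstab * S) * ‖v‖) ^ 2 := by
          rw [mul_pow, Real.sq_sqrt (mul_nonneg hC.le hS0)]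
          ring
end
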